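/- Let d ≥ 1, β > 0 and let U = V + g satisfy assumptions (A0), (A1) and (A2). Then the coarse-grained potential F is twice continuously differentiable on ℝ^{2d} and satisfies the random walk representation condition: there exist constants 0 < c ≤ C < ∞, independent of a ∈ ℝ^{2d}, such that for all a ∈ ℝ^{2d}: (i) for every index i ∈ {1,…,2d}, ∂²F/∂a_i²(a) = − Σ_{j ≠ i} ∂²F/∂a_i∂a_j(a); and (ii) for all i ≠ j, c ≤ − ∂²F/∂a_i∂a_j(a) ≤ C. -/

import Mathlib

open MeasureTheory Real Filter

noncomputable section

/-- Boltzmann weight of the single odd site given the `2d` neighbouring values `a`. -/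
def siteWeight (β : ℝ) (d : ℕ) (U : ℝ → ℝ) (a : Fin (2*d) → ℝ) (t : ℝ) : ℝ :=
  Real.exp (-(2*β) * ∑ k, U (a k - t))

/-- Normalising constant `Z_a`. -/
def Zsite (β : ℝ) (d : ℕ) (U : ℝ → ℝ) (a : Fin (2*d) → ℝ) : ℝ :=
  ∫ t : ℝ, siteWeight β d U a t

/-- Coarse-grained potential `F(a) = -log Z_a`. -/
def Fcg (β : ℝ) (d : ℕ) (U : ℝ → ℝ) (a : Fin (2*d) → ℝ) : ℝ :=
  - Real.log (Zsite β d U a)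

/-- Second partial derivative. -/
def pd2 {n : ℕ} (Φ : (Fin n → ℝ) → ℝ) (i j : Fin n) (a : Fin n → ℝ) : ℝ :=
  fderiv ℝ (fun x => fderiv ℝ Φ x (Pi.single i 1)) a (Pi.single j 1)

/-- `L^q(ℝ)` norm. -/
def LqNorm (f : ℝ → ℝ) (q : ℝ) : ℝ := (∫ t : ℝ, |f t| ^ q) ^ (1/q)

/-- Locally uniformly dominated continuous integrands. -/
def Adm {n : ℕ} (φ : (Fin n → ℝ) → ℝ → ℝ) : Prop :=
  Continuous (fun p : (Fin n → ℝ) × ℝ => φ p.1 p.2) ∧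
  ∀ R : ℝ, ∃ bd : ℝ → ℝ, Integrable bd ∧ ∀ a : Fin n → ℝ, ‖a‖ ≤ R → ∀ t, |φ a t| ≤ bd t

lemma Adm.cont_t {n : ℕ} {φ : (Fin n → ℝ) → ℝ → ℝ} (h : Adm φ) (a : Fin n → ℝ) :
    Continuous (φ a) := h.1.comp (by fun_prop : Continuous fun t : ℝ => (a, t))

lemma Adm.cont_a {n : ℕ} {φ : (Fin n → ℝ) → ℝ → ℝ} (h : Adm φ) (t : ℝ) :
    Continuous (fun a => φ a t) := h.1.comp (by fun_prop : Continuous fun a : Fin n → ℝ => (a, t))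

lemma Adm.integrable {n : ℕ} {φ : (Fin n → ℝ) → ℝ → ℝ} (h : Adm φ) (a : Fin n → ℝ) :
    Integrable (φ a) := by
  obtain ⟨bd, hb, hle⟩ := h.2 ‖a‖
  exact hb.mono' (h.cont_t a).aestronglyMeasurable (Eventually.of_forall (hle a le_rfl))

lemma Adm.continuous {n : ℕ} {φ : (Fin n → ℝ) → ℝ → ℝ} (h : Adm φ) :
    Continuous (fun a => ∫ t, φ a t) := by
  rw [continuous_iff_continuousAt]
  intro a
  obtain ⟨bd, hb, hle⟩ := h.2 (‖a‖ + 1)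
  refine continuousAt_of_dominated (bound := bd) ?_ ?_ hb ?_
  · exact Eventually.of_forall fun x => (h.cont_t x).aestronglyMeasurable
  · have : ∀ᶠ x in nhds a, ‖x‖ < ‖a‖ + 1 :=
      (continuous_norm.tendsto a).eventually (gt_mem_nhds (by linarith))
    filter_upwards [this] with x hx
    exact Eventually.of_forall (hle x hx.le)
  · exact Eventually.of_forall fun t => (h.cont_a t).continuousAt

lemma Adm.hasFDerivAt {n : ℕ} {φ : (Fin n → ℝ) → ℝ → ℝ} {ψ : Fin n → (Fin n → ℝ) → ℝ → ℝ}
    (h : Adm φ) (hψ : ∀ j, Adm (ψ j))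
    (hd : ∀ a t, HasFDerivAt (fun x => φ x t)
      (∑ j, ψ j a t • ContinuousLinearMap.proj (R := ℝ) (φ := fun _ : Fin n => ℝ) j) a)
    (a : Fin n → ℝ) :
    HasFDerivAt (fun x => ∫ t, φ x t)
      (∑ j, (∫ t, ψ j a t) • ContinuousLinearMap.proj (R := ℝ) (φ := fun _ : Fin n => ℝ) j) a := by
  choose bd hb hle using fun j => (hψ j).2 (‖a‖ + 1)
  have key := hasFDerivAt_integral_of_dominated_of_fderiv_le (μ := volume) (𝕜 := ℝ)
    (F := φ) (x₀ := a) (s := Metric.ball a 1)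
    (F' := fun a t => ∑ j, ψ j a t • ContinuousLinearMap.proj (R := ℝ) (φ := fun _ : Fin n => ℝ) j)
    (bound := fun t => ∑ j, bd j t *
      ‖ContinuousLinearMap.proj (R := ℝ) (φ := fun _ : Fin n => ℝ) j‖)
    (Metric.ball_mem_nhds a one_pos)
    (Eventually.of_forall fun x => (h.cont_t x).aestronglyMeasurable) (h.integrable a) ?_ ?_ ?_ ?_
  · rw [integral_finsetSum _ (fun j _ => ((hψ j).integrable a).smul_const _)] at key
    simp only [integral_smul_const] at key
    exact key
  · refine Continuous.aestronglyMeasurable ?_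
    refine continuous_finsetSum _ fun j _ => ?_
    exact ((hψ j).cont_t a).smul continuous_const
  · refine Eventually.of_forall fun t x hx => ?_
    refine (norm_sum_le _ _).trans (Finset.sum_le_sum fun j _ => ?_)
    rw [norm_smul]
    refine mul_le_mul_of_nonneg_right (hle j x ?_ t) (norm_nonneg _)
    have : ‖x - a‖ < 1 := by simpa [dist_eq_norm] using hx
    have h2 := norm_sub_norm_le x a
    linarith
  · exact integrable_finsetSum _ fun j _ => (hb j).mul_const _
  · exact Eventually.of_forall fun t x _ => hd x t

lemma adm_weight {d : ℕ} {β A B K : ℝ} {U : ℝ → ℝ} (hd : 1 ≤ d) (hβ : 0 < β)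
    (hUcont : Continuous U) (hA : 0 < A) (hA0 : ∀ η : ℝ, A * η ^ 2 - B ≤ U η)
    {p : (Fin (2*d) → ℝ) → ℝ → ℝ} (hp : Continuous (fun x : (Fin (2*d) → ℝ) × ℝ => p x.1 x.2))
    (hK : ∀ a t, |p a t| ≤ K * (1 + ‖a‖ + |t|) ^ 2) :
    Adm (fun a t => p a t * siteWeight β d U a t) := by
  have hK0 : 0 ≤ K := by
    have h1 := (abs_nonneg _).trans (hK 0 0)
    simpa using h1
  refine ⟨?_, fun R => ?_⟩
  · refine hp.mul ?_
    unfold siteWeight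
    fun_prop
  · set b : ℝ := β * (2*d) * A with hb
    have hbpos : 0 < b := by
      have : (0:ℝ) < d := by exact_mod_cast hd
      positivity
    set D : ℝ := Real.exp (2*β*((2*d) * (B + A * R^2))) with hD
    refine ⟨fun t => K * 2 * D * ((1 + |R|)^2 * Real.exp (-b * t^2) + t^2 * Real.exp (-b*t^2)), ?_, ?_⟩
    · refine Integrable.const_mul ?_ _
      refine ((integrable_exp_neg_mul_sq hbpos).const_mul _).add ?_
      have := integrable_rpow_mul_exp_neg_mul_sq hbpos (s := 2) (by norm_num)
      simpa using this
    · intro a ha t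
      have hR : 0 ≤ R := (norm_nonneg _).trans ha
      have hw : siteWeight β d U a t ≤ D * Real.exp (-b*t^2) := by
        unfold siteWeight
        rw [hD, ← Real.exp_add]
        apply Real.exp_le_exp.2
        have hk : ∀ k : Fin (2*d), A * (t^2/2) - (B + A * R^2) ≤ U (a k - t) := by
          intro k
          refine le_trans ?_ (hA0 _)
          have h1 : |a k| ≤ R := (norm_le_pi_norm a k).trans ha
          have h2 : (a k)^2 ≤ R^2 := sq_le_sq' (by linarith [neg_abs_le (a k)]) ((le_abs_self _).trans h1)
          nlinarith [mul_nonneg hA.le (sq_nonneg (2 * a k - t)), mul_le_mul_of_nonneg_left h2 hA.le]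
        have hs := Finset.sum_le_sum (s := Finset.univ) fun k _ => hk k
        simp only [Finset.sum_const, Finset.card_univ, Fintype.card_fin, nsmul_eq_mul] at hs
        push_cast at hs
        rw [hb]
        nlinarith [mul_le_mul_of_nonneg_left hs hβ.le]
      have hw0 : 0 < siteWeight β d U a t := Real.exp_pos _
      rw [abs_mul, abs_of_pos hw0]
      have hpa : |p a t| ≤ K * 2 * ((1+|R|)^2 + t^2) := by
        refine (hK a t).trans ?_
        rw [mul_assoc]
        refine mul_le_mul_of_nonneg_left ?_ hK0
        rw [abs_of_nonneg hR, ← sq_abs t]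
        have h0 := norm_nonneg a
        have h3 := abs_nonneg t
        calc (1 + ‖a‖ + |t|)^2 ≤ (1 + R + |t|)^2 := by gcongr
          _ ≤ _ := by nlinarith [sq_nonneg (1 + R - |t|)]
      calc |p a t| * siteWeight β d U a t ≤ (K * 2 * ((1+|R|)^2 + t^2)) * (D * Real.exp (-b*t^2)) := by
            gcongr
        _ = _ := by ring

lemma lin6 {p1 p2 p3 p4 p5 p6 : ℝ → ℝ} (h1 : Integrable p1) (h2 : Integrable p2)
    (h3 : Integrable p3) (h4 : Integrable p4) (h5 : Integrable p5) (h6 : Integrable p6)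
    (c1 c2 c3 c4 c5 c6 : ℝ) :
    ∫ t, (c1 * p1 t + c2 * p2 t + c3 * p3 t + c4 * p4 t + c5 * p5 t + c6 * p6 t) =
    c1 * (∫ t, p1 t) + c2 * (∫ t, p2 t) + c3 * (∫ t, p3 t) + c4 * (∫ t, p4 t)
      + c5 * (∫ t, p5 t) + c6 * (∫ t, p6 t) := by
  have i1 := h1.const_mul c1
  have i2 := i1.add (h2.const_mul c2)
  have i3 := i2.add (h3.const_mul c3)
  have i4 := i3.add (h4.const_mul c4)
  have i5 := i4.add (h5.const_mul c5)
  have e6 := integral_add i5 (h6.const_mul c6)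
  have e5 := integral_add i4 (h5.const_mul c5)
  have e4 := integral_add i3 (h4.const_mul c4)
  have e3 := integral_add i2 (h3.const_mul c3)
  have e2 := integral_add i1 (h2.const_mul c2)
  simp only [Pi.add_apply, integral_const_mul] at e2 e3 e4 e5 e6
  rw [e6, e5, e4, e3, e2]

lemma cov_lower {w f g : ℝ → ℝ} {α γ : ℝ} (hw : ∀ t, 0 ≤ w t)
    (hfg : Integrable fun t => f t * g t * w t) (hf : Integrable fun t => f t * w t)
    (hg : Integrable fun t => g t * w t) (hwi : Integrable w)
    (ht2 : Integrable fun t => t ^ 2 * w t) (ht : Integrable fun t => t * w t)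
    (h : ∀ s t, α * (t - s) ^ 2 - γ ≤ (f t - f s) * (g t - g s)) :
    α * (2 * ((∫ t, w t) * (∫ t, t ^ 2 * w t) - (∫ t, t * w t) ^ 2)) - γ * (∫ t, w t) ^ 2 ≤
    2 * ((∫ t, w t) * (∫ t, f t * g t * w t) - (∫ t, f t * w t) * (∫ t, g t * w t)) := by
  set Z := ∫ t, w t
  set T2 := ∫ t, t ^ 2 * w t
  set T1 := ∫ t, t * w t
  set P := ∫ t, f t * g t * w t
  set Pf := ∫ t, f t * w t
  set Pg := ∫ t, g t * w t
  have s1 : ∀ s, 0 ≤ P - g s * Pf - f s * Pg + f s * g s * Z - α * T2 + 2 * α * s * T1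
      - α * s ^ 2 * Z + γ * Z := by
    intro s
    have e := lin6 hfg hf hg hwi ht2 ht 1 (-g s) (-f s) (f s * g s - α * s ^ 2 + γ) (-α) (2 * α * s)
    have hn : 0 ≤ ∫ t, (1 * (f t * g t * w t) + (-g s) * (f t * w t) + (-f s) * (g t * w t)
        + (f s * g s - α * s ^ 2 + γ) * w t + (-α) * (t ^ 2 * w t) + (2 * α * s) * (t * w t)) := by
      refine integral_nonneg fun t => ?_
      have := mul_nonneg (sub_nonneg.2 (h s t)) (hw t)
      simp only [Pi.zero_apply]
      nlinarith
    rw [e] at hn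
    linarith
  have e := lin6 hfg hf hg hwi ht2 ht Z (-Pg) (-Pf) (P - α * T2 + γ * Z) (-α * Z) (2 * α * T1)
  have hn : 0 ≤ ∫ t, (Z * (f t * g t * w t) + (-Pg) * (f t * w t) + (-Pf) * (g t * w t)
      + (P - α * T2 + γ * Z) * w t + (-α * Z) * (t ^ 2 * w t) + (2 * α * T1) * (t * w t)) := by
    refine integral_nonneg fun t => ?_
    have := mul_nonneg (s1 t) (hw t)
    simp only [Pi.zero_apply]
    nlinarith
  rw [e] at hn
  change 0 ≤ Z * P + -Pg * Pf + -Pf * Pg + (P - α * T2 + γ * Z) * Z + -α * Z * T2 + 2 * α * T1 * T1 at hn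
  nlinarith

lemma var_lower {w W1 W2 : ℝ → ℝ} {M : ℝ} (hM : 0 < M) (hw : ∀ t, 0 ≤ w t)
    (hZ : 0 < ∫ t, w t)
    (hdw : ∀ t, HasDerivAt w (-W1 t * w t) t) (hdW : ∀ t, HasDerivAt W1 (W2 t) t)
    (hWM : ∀ t, W2 t ≤ M) (hwi : Integrable w)
    (ht2 : Integrable fun t => t ^ 2 * w t) (ht : Integrable fun t => t * w t)
    (h1 : Integrable fun t => W1 t * w t) (ht1 : Integrable fun t => t * W1 t * w t)
    (h11 : Integrable fun t => W1 t * W1 t * w t) (h2 : Integrable fun t => W2 t * w t) :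
    (∫ t, w t) ^ 2 / M ≤ (∫ t, w t) * (∫ t, t ^ 2 * w t) - (∫ t, t * w t) ^ 2 := by
  set Z := ∫ t, w t
  set T2 := ∫ t, t ^ 2 * w t
  set T1 := ∫ t, t * w t
  have a1 : ∫ t, W1 t * w t = 0 := by
    have := integral_eq_zero_of_hasDerivAt_of_integrable hdw (by simpa using h1.neg) hwi
    simpa [integral_neg] using this
  have a2 : ∫ t, t * W1 t * w t = Z := by
    have := integral_eq_zero_of_hasDerivAt_of_integrable
      (f := fun t => t * w t) (f' := fun t => w t - t * W1 t * w t)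
      (fun t => by
        refine ((hasDerivAt_id t).mul (hdw t)).congr_deriv ?_
        simp only [id]; ring) (hwi.sub ht1) ht
    rw [integral_sub hwi ht1] at this
    linarith
  have a3 : ∫ t, W1 t * W1 t * w t = ∫ t, W2 t * w t := by
    have := integral_eq_zero_of_hasDerivAt_of_integrable
      (f := fun t => W1 t * w t) (f' := fun t => W2 t * w t - W1 t * W1 t * w t)
      (fun t => by
        refine ((hdW t).mul (hdw t)).congr_deriv ?_
        ring) (h2.sub h11) h1
    rw [integral_sub h2 h11] at this
    linarith
  have a4 : ∫ t, W2 t * w t ≤ M * Z := by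
    rw [← integral_const_mul]
    exact integral_mono h2 (hwi.const_mul M) fun t => mul_le_mul_of_nonneg_right (hWM t) (hw t)
  have key : ∀ m : ℝ, 0 ≤ T2 - 2 * m * T1 + m ^ 2 * Z - Z / M := by
    intro m
    have e := lin6 ht2 ht hwi h1 ht1 h11 1 (-2 * m) (m ^ 2) (2 * m / M) (-2 / M) (1 / M ^ 2)
    have hn : 0 ≤ ∫ t, (1 * (t ^ 2 * w t) + (-2 * m) * (t * w t) + (m ^ 2) * w t
      + (2 * m / M) * (W1 t * w t) + (-2 / M) * (t * W1 t * w t)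
      + (1 / M ^ 2) * (W1 t * W1 t * w t)) := by
      refine integral_nonneg fun t => ?_
      have := mul_nonneg (sq_nonneg (t - m - W1 t / M)) (hw t)
      simp only [Pi.zero_apply]
      convert this using 1
      field_simp
      ring
    rw [e, a1, a2, a3] at hn
    have h5 : 1 / M ^ 2 * ∫ t, W2 t * w t ≤ 1 / M ^ 2 * (M * Z) :=
      mul_le_mul_of_nonneg_left a4 (by positivity)
    have h6 : 1 / M ^ 2 * (M * Z) = Z / M := by field_simp
    have h7 : -2 / M * Z = - 2 * (Z / M) := by ring
    change 0 ≤ 1 * T2 + -2 * m * T1 + m ^ 2 * Z + 2 * m / M * 0 + -2 / M * Z + 1 / M ^ 2 * ∫ t, W2 t * w t at hn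
    linarith
  have hk := mul_nonneg (key (T1 / Z)) hZ.le
  have : (T2 - 2 * (T1 / Z) * T1 + (T1 / Z) ^ 2 * Z - Z / M) * Z = Z * T2 - T1 ^ 2 - Z ^ 2 / M := by
    field_simp
    ring
  linarith

lemma incr_bound {g : ℝ → ℝ} {q τ : ℝ} (hg : ContDiff ℝ 2 g)
    (hg'' : ∀ s, deriv (deriv g) s ≤ 0) (hq : 1 ≤ q) (hτ : 0 < τ)
    (hgq : Integrable (fun t : ℝ => |deriv (deriv g) t| ^ q)) (p r : ℝ) (hr : 0 < r) :
    0 ≤ deriv g p - deriv g (p + r) ∧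
    (deriv g p - deriv g (p + r)) ^ 2 * τ ^ (1 / q) ≤
      (LqNorm (deriv (deriv g)) q) ^ 2 * ((1 - 1 / q) * r ^ 2 + τ / q) := by
  have hg1 : ContDiff ℝ 1 (deriv g) := ((contDiff_succ_iff_deriv (n := 1)).1 hg).2.2
  have hg2c : Continuous (deriv (deriv g)) := hg1.continuous_deriv_one
  have hgd : Differentiable ℝ (deriv g) := hg1.differentiable one_ne_zero
  have hq0 : 0 < q := by linarith
  set H := deriv g p - deriv g (p + r) with hH
  set I := ∫ t : ℝ, |deriv (deriv g) t| ^ q with hI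
  have hint : ∫ t in Set.Ioc p (p + r), |deriv (deriv g) t| = H := by
    rw [← intervalIntegral.integral_of_le (by linarith)]
    have e : ∀ t, |deriv (deriv g) t| = - deriv (deriv g) t := fun t => abs_of_nonpos (hg'' t)
    simp only [e]
    rw [intervalIntegral.integral_neg, intervalIntegral.integral_deriv_eq_sub
      (fun x _ => hgd x) (hg2c.intervalIntegrable _ _)]
    ring
  have hH0 : 0 ≤ H := by
    rw [← hint]
    exact integral_nonneg fun t => abs_nonneg _
  refine ⟨hH0, ?_⟩
  have hI0 : 0 ≤ I := integral_nonneg fun t => by positivity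
  have jens := (convexOn_rpow hq).map_set_average_le (μ := volume) (t := Set.Ioc p (p + r))
    (f := fun t => |deriv (deriv g) t|)
    (continuousOn_id.rpow_const (fun x _ => Or.inr hq0.le)) isClosed_Ici
    (by simp [hr]) (by simp) (Eventually.of_forall fun t => Set.mem_Ici.2 (abs_nonneg _))
    (hg2c.abs.integrableOn_Ioc) hgq.integrableOn
  rw [setAverage_eq, setAverage_eq, hint] at jens
  have hvol : volume.real (Set.Ioc p (p + r)) = r := by
    simp [hr.le]
  rw [hvol, smul_eq_mul, smul_eq_mul] at jens
  have hle : ∫ t in Set.Ioc p (p + r), |deriv (deriv g) t| ^ q ≤ I :=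
    setIntegral_le_integral hgq (Eventually.of_forall fun t => by positivity)
  have j2 : (r⁻¹ * H) ^ q ≤ r⁻¹ * I := jens.trans (by gcongr)
  have j3 : r⁻¹ * H ≤ (r⁻¹ * I) ^ (1 / q) := by
    have := Real.rpow_le_rpow (by positivity) j2 (by positivity : 0 ≤ 1 / q)
    rwa [← Real.rpow_mul (by positivity), mul_one_div_cancel hq0.ne', Real.rpow_one] at this
  rw [Real.mul_rpow (by positivity) hI0] at j3
  have hN : LqNorm (deriv (deriv g)) q = I ^ (1 / q) := rfl
  rw [hN]
  set N := I ^ (1 / q)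
  have hN0 : 0 ≤ N := by positivity
  have j4 : H ≤ N * r ^ (1 - 1 / q) := by
    have : H = r * (r⁻¹ * H) := by field_simp
    rw [this]
    calc r * (r⁻¹ * H) ≤ r * (r⁻¹ ^ (1 / q) * N) := by gcongr
      _ = N * r ^ (1 - 1 / q) := by
        rw [Real.rpow_sub hr, Real.rpow_one, Real.inv_rpow hr.le]; ring
  have j5 : H ^ 2 ≤ N ^ 2 * (r ^ 2) ^ (1 - 1 / q) := by
    calc H ^ 2 ≤ (N * r ^ (1 - 1 / q)) ^ 2 := by gcongr
      _ = _ := by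
        rw [mul_pow, ← Real.rpow_natCast (r ^ (1 - 1 / q)), ← Real.rpow_mul hr.le,
          ← Real.rpow_natCast r, ← Real.rpow_mul hr.le, mul_comm (1 - 1 / q)]
  have hq1 : 1 / q ≤ 1 := by rw [div_le_one hq0]; exact hq
  have am := Real.geom_mean_le_arith_mean2_weighted (w₁ := 1 - 1 / q) (w₂ := 1 / q)
    (p₁ := r ^ 2) (p₂ := τ) (by linarith) (by positivity) (by positivity) hτ.le (by ring)
  calc H ^ 2 * τ ^ (1 / q) ≤ (N ^ 2 * (r ^ 2) ^ (1 - 1 / q)) * τ ^ (1 / q) := by gcongr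
    _ = N ^ 2 * ((r ^ 2) ^ (1 - 1 / q) * τ ^ (1 / q)) := by ring
    _ ≤ N ^ 2 * ((1 - 1 / q) * r ^ 2 + 1 / q * τ) := by gcongr
    _ = _ := by ring

lemma alg_lower {x y H1 H2 C₁ C₂ θ r E : ℝ} (hC₁ : 0 < C₁) (hC₂ : 0 < C₂) (hθ : 0 < θ) (hθ1 : θ < 1)
    (hr : 0 < r) (hx : C₁ * r ≤ x) (hx2 : x ≤ C₂ * r) (hy : C₁ * r ≤ y) (hy2 : y ≤ C₂ * r)
    (h1 : 0 ≤ H1) (h2 : 0 ≤ H2) (h1E : H1 ^ 2 ≤ θ ^ 2 * C₁ ^ 3 / (4 * C₂) * E)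
    (h2E : H2 ^ 2 ≤ θ ^ 2 * C₁ ^ 3 / (4 * C₂) * E) :
    C₁ ^ 2 * r ^ 2 * (1 - θ / 2) - θ * C₁ ^ 2 / 2 * E ≤ (x - H1) * (y - H2) := by
  have aux : ∀ x y H : ℝ, C₁ * r ≤ x → x ≤ C₂ * r → C₁ * r ≤ y →
      H ^ 2 ≤ θ ^ 2 * C₁ ^ 3 / (4 * C₂) * E → x * H ≤ θ / 4 * (x * y) + θ * C₁ ^ 2 / 4 * E := by
    intro x y H hx hx2 hy hE
    have hx0 : 0 < x := lt_of_lt_of_le (by positivity) hx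
    have e1 : 0 ≤ θ * C₁ / (4 * C₂) * (x - 2 * C₂ / (θ * C₁) * H) ^ 2 := by positivity
    have e2 : θ * C₁ / (4 * C₂) * (x - 2 * C₂ / (θ * C₁) * H) ^ 2 =
        θ * C₁ / (4 * C₂) * x ^ 2 - x * H + C₂ / (θ * C₁) * H ^ 2 := by
      field_simp
      ring
    have e3 : C₂ / (θ * C₁) * H ^ 2 ≤ θ * C₁ ^ 2 / 4 * E := by
      calc C₂ / (θ * C₁) * H ^ 2 ≤ C₂ / (θ * C₁) * (θ ^ 2 * C₁ ^ 3 / (4 * C₂) * E) := by gcongr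
        _ = _ := by field_simp
    have e4 : θ * C₁ / (4 * C₂) * x ^ 2 ≤ θ / 4 * (x * y) := by
      have h5 : C₁ * x ≤ C₂ * y := by nlinarith
      have h6 : θ / (4 * C₂) * x * (C₁ * x) ≤ θ / (4 * C₂) * x * (C₂ * y) := by gcongr
      calc θ * C₁ / (4 * C₂) * x ^ 2 = θ / (4 * C₂) * x * (C₁ * x) := by ring
        _ ≤ _ := h6
        _ = _ := by field_simp
    linarith
  have a1 := aux x y H2 hx hx2 hy h2E
  have a2 := aux y x H1 hy hy2 hx h1E
  have a3 : C₁ ^ 2 * r ^ 2 ≤ x * y := by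
    have : (C₁ * r) * (C₁ * r) ≤ x * y := mul_le_mul hx hy (by positivity) (by nlinarith)
    nlinarith
  have a4 : C₁ ^ 2 * r ^ 2 * (1 - θ / 2) ≤ x * y * (1 - θ / 2) :=
    mul_le_mul_of_nonneg_right a3 (by linarith)
  nlinarith [mul_nonneg h1 h2]

lemma pair_lower {C₁ C₂ q τ θ : ℝ} {V g : ℝ → ℝ}
    (hV : ContDiff ℝ 2 V) (hg : ContDiff ℝ 2 g)
    (hC₁ : 0 < C₁) (hC₂ : 0 < C₂)
    (hV'' : ∀ s, C₁ ≤ deriv (deriv V) s ∧ deriv (deriv V) s ≤ C₂)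
    (hg'' : ∀ s, deriv (deriv g) s ≤ 0)
    (hq : 1 ≤ q) (hτ : 0 < τ) (hθ : 0 < θ) (hθ1 : θ < 1)
    (hgq : Integrable (fun t : ℝ => |deriv (deriv g) t| ^ q))
    (hN : (LqNorm (deriv (deriv g)) q) ^ 2 ≤ θ ^ 2 * C₁ ^ 3 / (4 * C₂) * τ ^ (1 / q))
    (b b' s t : ℝ) :
    C₁ ^ 2 * (1 - θ + θ / (2 * q)) * (t - s) ^ 2 - C₁ ^ 2 * θ * τ / (2 * q) ≤
    ((deriv V (b - t) + deriv g (b - t)) - (deriv V (b - s) + deriv g (b - s))) *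
    ((deriv V (b' - t) + deriv g (b' - t)) - (deriv V (b' - s) + deriv g (b' - s))) := by
  have hq0 : 0 < q := by linarith
  have hV1 : ContDiff ℝ 1 (deriv V) := ((contDiff_succ_iff_deriv (n := 1)).1 hV).2.2
  have hVd : Differentiable ℝ (deriv V) := hV1.differentiable one_ne_zero
  have hx : ∀ p r : ℝ, 0 < r → C₁ * r ≤ deriv V (p + r) - deriv V p ∧
      deriv V (p + r) - deriv V p ≤ C₂ * r := by
    intro p r hr
    constructor
    · have := mul_sub_le_image_sub_of_le_deriv hVd (fun x => (hV'' x).1) (x := p) (y := p + r) (by linarith)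
      simpa using this
    · have := image_sub_le_mul_sub_of_deriv_le hVd (fun x => (hV'' x).2) (x := p) (y := p + r) (by linarith)
      simpa using this
  have hT : 0 < τ ^ (1 / q) := by positivity
  have hH : ∀ p r : ℝ, 0 < r → (deriv g p - deriv g (p + r)) ^ 2 ≤
      θ ^ 2 * C₁ ^ 3 / (4 * C₂) * ((1 - 1 / q) * r ^ 2 + τ / q) := by
    intro p r hr
    have h1 := (incr_bound hg hg'' hq hτ hgq p r hr).2
    have hE : 0 ≤ (1 - 1 / q) * r ^ 2 + τ / q := by
      have hq1 : 1 / q ≤ 1 := by rw [div_le_one hq0]; exact hq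
      have : 0 ≤ 1 - 1 / q := by linarith
      positivity
    have h2 := mul_le_mul_of_nonneg_right hN hE
    have h3 := h1.trans h2
    refine le_of_mul_le_mul_right (h3.trans (le_of_eq ?_)) hT
    ring
  have main : ∀ p p' r : ℝ, 0 < r →
      C₁ ^ 2 * (1 - θ + θ / (2 * q)) * r ^ 2 - C₁ ^ 2 * θ * τ / (2 * q) ≤
      ((deriv V (p + r) + deriv g (p + r)) - (deriv V p + deriv g p)) *
      ((deriv V (p' + r) + deriv g (p' + r)) - (deriv V p' + deriv g p')) := by
    intro p p' r hr
    have := alg_lower hC₁ hC₂ hθ hθ1 hr (hx p r hr).1 (hx p r hr).2 (hx p' r hr).1 (hx p' r hr).2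
      (incr_bound hg hg'' hq hτ hgq p r hr).1 (incr_bound hg hg'' hq hτ hgq p' r hr).1
      (hH p r hr) (hH p' r hr)
    calc _ = C₁ ^ 2 * r ^ 2 * (1 - θ / 2) - θ * C₁ ^ 2 / 2 * ((1 - 1 / q) * r ^ 2 + τ / q) := by
          field_simp
          ring
      _ ≤ _ := this
      _ = _ := by ring
  rcases lt_trichotomy s t with h | h | h
  · have := main (b - t) (b' - t) (t - s) (by linarith)
    rw [sub_add_sub_cancel, sub_add_sub_cancel] at this
    linarith
  · subst h
    have : 0 ≤ C₁ ^ 2 * θ * τ / (2 * q) := by positivity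
    simpa using this
  · have := main (b - s) (b' - s) (s - t) (by linarith)
    rw [sub_add_sub_cancel, sub_add_sub_cancel] at this
    linarith

structure Good (d : ℕ) (β : ℝ) (U U1 U2 : ℝ → ℝ) (K : ℝ) : Prop where
  adm : ∀ (p : (Fin (2*d) → ℝ) → ℝ → ℝ) (L : ℝ),
    Continuous (fun x : (Fin (2*d) → ℝ) × ℝ => p x.1 x.2) →
    (∀ a t, |p a t| ≤ L * (1 + ‖a‖ + |t|) ^ 2) → Adm (fun a t => p a t * siteWeight β d U a t)
  d1 : ∀ s, HasDerivAt U (U1 s) s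
  d2 : ∀ s, HasDerivAt U1 (U2 s) s
  c2 : Continuous U2
  b1 : ∀ s, |U1 s| ≤ K * (1 + |s|)
  b2 : ∀ s, |U2 s| ≤ K
  K0 : 0 ≤ K

namespace Good

variable {d : ℕ} {β K : ℝ} {U U1 U2 : ℝ → ℝ}

lemma c1 (h : Good d β U U1 U2 K) : Continuous U1 :=
  continuous_iff_continuousAt.2 fun s => (h.d2 s).continuousAt

lemma bd1 (h : Good d β U U1 U2 K) (i : Fin (2*d)) (a : Fin (2*d) → ℝ) (t : ℝ) :
    |U1 (a i - t)| ≤ K * (1 + ‖a‖ + |t|) := by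
  refine (h.b1 _).trans (mul_le_mul_of_nonneg_left ?_ h.K0)
  have h1 : |a i| ≤ ‖a‖ := norm_le_pi_norm a i
  have h2 := abs_sub (a i) t
  linarith

lemma admProd (h : Good d β U U1 U2 K) {p p' : (Fin (2*d) → ℝ) → ℝ → ℝ} (L L' : ℝ)
    (hc : Continuous (fun x : (Fin (2*d) → ℝ) × ℝ => p x.1 x.2))
    (hc' : Continuous (fun x : (Fin (2*d) → ℝ) × ℝ => p' x.1 x.2))
    (hp : ∀ a t, |p a t| ≤ L * (1 + ‖a‖ + |t|)) (hp' : ∀ a t, |p' a t| ≤ L' * (1 + ‖a‖ + |t|)) :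
    Adm (fun a t => p a t * p' a t * siteWeight β d U a t) := by
  refine h.adm (fun a t => p a t * p' a t) (L * L') (hc.mul hc') fun a t => ?_
  rw [abs_mul]
  calc _ ≤ (L * (1 + ‖a‖ + |t|)) * (L' * (1 + ‖a‖ + |t|)) :=
        mul_le_mul (hp a t) (hp' a t) (abs_nonneg _) ((abs_nonneg _).trans (hp a t))
    _ = _ := by ring

lemma admLin (h : Good d β U U1 U2 K) {p : (Fin (2*d) → ℝ) → ℝ → ℝ} (L : ℝ)
    (hc : Continuous (fun x : (Fin (2*d) → ℝ) × ℝ => p x.1 x.2))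
    (hp : ∀ a t, |p a t| ≤ L * (1 + ‖a‖ + |t|)) :
    Adm (fun a t => p a t * siteWeight β d U a t) := by
  have := h.admProd (p' := fun _ _ => 1) L 1 hc continuous_const hp (fun a t => by
    simp; linarith [norm_nonneg a, abs_nonneg t])
  simpa using this

lemma admBdd (h : Good d β U U1 U2 K) {p : (Fin (2*d) → ℝ) → ℝ → ℝ} (L : ℝ)
    (hc : Continuous (fun x : (Fin (2*d) → ℝ) × ℝ => p x.1 x.2))
    (hp : ∀ a t, |p a t| ≤ L) :
    Adm (fun a t => p a t * siteWeight β d U a t) := by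
  refine h.admLin L hc fun a t => (hp a t).trans ?_
  have h0 := (abs_nonneg _).trans (hp a t)
  nlinarith [norm_nonneg a, abs_nonneg t, mul_nonneg h0 (norm_nonneg a), mul_nonneg h0 (abs_nonneg t)]

lemma admw (h : Good d β U U1 U2 K) : Adm (siteWeight β d U) := by
  have := h.admBdd (p := fun _ _ => 1) 1 continuous_const (by simp)
  simpa using this

lemma cont1 (h : Good d β U U1 U2 K) (i : Fin (2*d)) :
    Continuous (fun x : (Fin (2*d) → ℝ) × ℝ => U1 (x.1 i - x.2)) := by
  have := h.c1
  fun_prop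

lemma cont2 (h : Good d β U U1 U2 K) (i : Fin (2*d)) :
    Continuous (fun x : (Fin (2*d) → ℝ) × ℝ => U2 (x.1 i - x.2)) := by
  have := h.c2
  fun_prop

lemma adm1 (h : Good d β U U1 U2 K) (i : Fin (2*d)) :
    Adm (fun a t => U1 (a i - t) * siteWeight β d U a t) :=
  h.admLin K (h.cont1 i) (h.bd1 i)

lemma adm11 (h : Good d β U U1 U2 K) (i j : Fin (2*d)) :
    Adm (fun a t => U1 (a i - t) * U1 (a j - t) * siteWeight β d U a t) :=
  h.admProd (p := fun a t => U1 (a i - t)) (p' := fun a t => U1 (a j - t)) K K (h.cont1 i) (h.cont1 j) (h.bd1 i) (h.bd1 j)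

lemma adm2 (h : Good d β U U1 U2 K) (i : Fin (2*d)) :
    Adm (fun a t => U2 (a i - t) * siteWeight β d U a t) :=
  h.admBdd K (h.cont2 i) (fun _ _ => h.b2 _)

end Good

lemma Adm.const_mul {n : ℕ} {φ : (Fin n → ℝ) → ℝ → ℝ} (h : Adm φ) (c : ℝ) :
    Adm (fun a t => c * φ a t) := by
  refine ⟨continuous_const.mul h.1, fun R => ?_⟩
  obtain ⟨bd, hb, hle⟩ := h.2 R
  refine ⟨fun t => |c| * bd t, hb.const_mul _, fun a ha t => ?_⟩
  rw [abs_mul]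
  exact mul_le_mul_of_nonneg_left (hle a ha t) (abs_nonneg _)

lemma Adm.add {n : ℕ} {φ ψ : (Fin n → ℝ) → ℝ → ℝ} (h : Adm φ) (h' : Adm ψ) :
    Adm (fun a t => φ a t + ψ a t) := by
  refine ⟨h.1.add h'.1, fun R => ?_⟩
  obtain ⟨bd, hb, hle⟩ := h.2 R
  obtain ⟨bd', hb', hle'⟩ := h'.2 R
  refine ⟨fun t => bd t + bd' t, hb.add hb', fun a ha t => ?_⟩
  exact (abs_add_le _ _).trans (add_le_add (hle a ha t) (hle' a ha t))

namespace Good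

variable {d : ℕ} {β K : ℝ} {U U1 U2 : ℝ → ℝ}

lemma hasFDerivAt_comp (f f' : ℝ → ℝ) (hf : ∀ s, HasDerivAt f (f' s) s) (i : Fin (2*d))
    (a : Fin (2*d) → ℝ) (t : ℝ) :
    HasFDerivAt (fun x : Fin (2*d) → ℝ => f (x i - t))
      (f' (a i - t) • ContinuousLinearMap.proj (R := ℝ) (φ := fun _ : Fin (2*d) => ℝ) i) a := by
  have h1 : HasFDerivAt (fun x : Fin (2*d) → ℝ => x i - t)
      (ContinuousLinearMap.proj (R := ℝ) (φ := fun _ : Fin (2*d) => ℝ) i) a :=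
    (hasFDerivAt_apply i a).sub_const t
  exact (hf (a i - t)).comp_hasFDerivAt a h1

lemma fderiv_w (h : Good d β U U1 U2 K) (a : Fin (2*d) → ℝ) (t : ℝ) :
    HasFDerivAt (fun x => siteWeight β d U x t)
      (∑ j, (-(2*β) * (U1 (a j - t) * siteWeight β d U a t)) •
        ContinuousLinearMap.proj (R := ℝ) (φ := fun _ : Fin (2*d) => ℝ) j) a := by
  have h1 := (HasFDerivAt.fun_sum (u := Finset.univ) fun k _ =>
    hasFDerivAt_comp U U1 h.d1 k a t).const_mul (-(2*β))
  have h2 := h1.exp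
  refine h2.congr_fderiv ?_
  rw [smul_smul, Finset.smul_sum]
  refine Finset.sum_congr rfl fun j _ => ?_
  rw [smul_smul]
  congr 1
  unfold siteWeight
  ring

lemma fderiv_Z (h : Good d β U U1 U2 K) (a : Fin (2*d) → ℝ) :
    HasFDerivAt (Zsite β d U)
      (∑ j, (-(2*β) * ∫ t, U1 (a j - t) * siteWeight β d U a t) •
        ContinuousLinearMap.proj (R := ℝ) (φ := fun _ : Fin (2*d) => ℝ) j) a := by
  have := Adm.hasFDerivAt h.admw (fun j => (h.adm1 j).const_mul (-(2*β))) h.fderiv_w a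
  simp only [integral_const_mul] at this
  exact this

/-- The second derivative integrals. -/
def Z2 (d : ℕ) (β : ℝ) (U U1 U2 : ℝ → ℝ) (i j : Fin (2*d)) (a : Fin (2*d) → ℝ) : ℝ :=
  ∫ t, ((2*β)^2 * (U1 (a i - t) * U1 (a j - t) * siteWeight β d U a t)
    + (if j = i then -(2*β) else 0) * (U2 (a i - t) * siteWeight β d U a t))

lemma adm_Z2 (h : Good d β U U1 U2 K) (i j : Fin (2*d)) :
    Adm (fun a t => (2*β)^2 * (U1 (a i - t) * U1 (a j - t) * siteWeight β d U a t)
    + (if j = i then -(2*β) else 0) * (U2 (a i - t) * siteWeight β d U a t)) :=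
  ((h.adm11 i j).const_mul _).add ((h.adm2 i).const_mul _)

lemma Z2_eq (h : Good d β U U1 U2 K) (i j : Fin (2*d)) (a : Fin (2*d) → ℝ) :
    Z2 d β U U1 U2 i j a = (2*β)^2 * (∫ t, U1 (a i - t) * U1 (a j - t) * siteWeight β d U a t)
    + (if j = i then -(2*β) else 0) * (∫ t, U2 (a i - t) * siteWeight β d U a t) := by
  unfold Z2
  rw [integral_add (((h.adm11 i j).integrable a).const_mul _) (((h.adm2 i).integrable a).const_mul _),
    integral_const_mul, integral_const_mul]

lemma fderiv_Z1 (h : Good d β U U1 U2 K) (i : Fin (2*d)) (a : Fin (2*d) → ℝ) :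
    HasFDerivAt (fun x => -(2*β) * ∫ t, U1 (x i - t) * siteWeight β d U x t)
      (∑ j, Z2 d β U U1 U2 i j a •
        ContinuousLinearMap.proj (R := ℝ) (φ := fun _ : Fin (2*d) => ℝ) j) a := by
  have := Adm.hasFDerivAt ((h.adm1 i).const_mul (-(2*β))) (h.adm_Z2 i) (fun a t => ?_) a
  · simp only [integral_const_mul] at this
    exact this
  · have h1 := ((hasFDerivAt_comp U1 U2 h.d2 i a t).mul (h.fderiv_w a t)).const_mul (-(2*β))
    refine h1.congr_fderiv ?_
    ext v
    simp only [smul_apply, add_apply, smul_eq_mul,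
      sum_apply, ContinuousLinearMap.proj_apply, add_mul, ite_mul, zero_mul,
      Finset.sum_add_distrib, Finset.sum_ite_eq', Finset.mem_univ, if_true]
    rw [mul_add, Finset.mul_sum, Finset.mul_sum]
    congr 1
    · refine Finset.sum_congr rfl fun j _ => ?_
      ring
    · ring

lemma Zpos (h : Good d β U U1 U2 K) (a : Fin (2*d) → ℝ) : 0 < Zsite β d U a :=
  integral_exp_pos (h.admw.integrable a)

lemma contDiff_Z1 (h : Good d β U U1 U2 K) (i : Fin (2*d)) :
    ContDiff ℝ 1 (fun x : Fin (2*d) → ℝ => -(2*β) * ∫ t, U1 (x i - t) * siteWeight β d U x t) := by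
  rw [contDiff_one_iff_fderiv]
  refine ⟨fun a => (h.fderiv_Z1 i a).differentiableAt, ?_⟩
  have : fderiv ℝ (fun x : Fin (2*d) → ℝ => -(2*β) * ∫ t, U1 (x i - t) * siteWeight β d U x t) =
    fun a => (∑ j, Z2 d β U U1 U2 i j a •
        ContinuousLinearMap.proj (R := ℝ) (φ := fun _ : Fin (2*d) => ℝ) j) :=
    funext fun a => (h.fderiv_Z1 i a).fderiv
  rw [this]
  refine continuous_finsetSum _ fun j _ => ?_
  exact (h.adm_Z2 i j).continuous.smul continuous_const

lemma contDiff_Z (h : Good d β U U1 U2 K) : ContDiff ℝ 2 (Zsite β d U) := by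
  have : (2 : WithTop ℕ∞) = 1 + 1 := by norm_num
  rw [this, contDiff_succ_iff_fderiv_apply]
  refine ⟨fun a => (h.fderiv_Z a).differentiableAt, by simp, fun y => ?_⟩
  simp only [(h.fderiv_Z _).fderiv, sum_apply, smul_apply,
    smul_eq_mul, ContinuousLinearMap.proj_apply]
  exact ContDiff.sum fun j _ => (h.contDiff_Z1 j).mul contDiff_const

lemma contDiff_F (h : Good d β U U1 U2 K) : ContDiff ℝ 2 (Fcg β d U) :=
  (h.contDiff_Z.log fun a => (h.Zpos a).ne').neg

lemma fderiv_F (h : Good d β U U1 U2 K) (i : Fin (2*d)) :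
    (fun x => fderiv ℝ (Fcg β d U) x (Pi.single i 1)) =
    fun x => -((-(2*β) * ∫ t, U1 (x i - t) * siteWeight β d U x t) * (Zsite β d U x)⁻¹) := by
  funext x
  have h1 := ((h.fderiv_Z x).log (h.Zpos x).ne').neg
  have h2 : fderiv ℝ (Fcg β d U) x = _ := h1.fderiv
  rw [h2]
  simp [Pi.single_apply]
  ring

lemma pd2_F (h : Good d β U U1 U2 K) (i j : Fin (2*d)) (a : Fin (2*d) → ℝ) :
    pd2 (Fcg β d U) i j a = -((Z2 d β U U1 U2 i j a * Zsite β d U a -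
      (2*β)^2 * ((∫ t, U1 (a i - t) * siteWeight β d U a t) *
        (∫ t, U1 (a j - t) * siteWeight β d U a t))) / (Zsite β d U a)^2) := by
  unfold pd2
  rw [h.fderiv_F i]
  have hz := (h.Zpos a).ne'
  have h1 := ((h.fderiv_Z1 i a).mul ((hasDerivAt_inv hz).comp_hasFDerivAt a (h.fderiv_Z a))).neg
  have h2 : fderiv ℝ (fun x => -((-(2*β) * ∫ t, U1 (x i - t) * siteWeight β d U x t) *
    (Zsite β d U x)⁻¹)) a = _ := h1.fderiv
  rw [h2]
  simp [Pi.single_apply]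
  field_simp
  ring

lemma F_shift (a : Fin (2*d) → ℝ) (s : ℝ) :
    Fcg β d U (a + fun _ => s) = Fcg β d U a := by
  unfold Fcg Zsite
  congr 2
  rw [← integral_add_right_eq_self (fun t => siteWeight β d U (a + fun _ => s) t) s]
  congr 1
  funext t
  unfold siteWeight
  simp [add_sub_add_right_eq_sub]

lemma rowsum (h : Good d β U U1 U2 K) (i : Fin (2*d)) (a : Fin (2*d) → ℝ) :
    ∑ j, pd2 (Fcg β d U) i j a = 0 := by
  unfold pd2
  rw [← map_sum]
  have hone : (∑ j : Fin (2*d), (Pi.single j 1 : Fin (2*d) → ℝ)) = fun _ => (1:ℝ) := by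
    funext k
    simp [Finset.sum_apply, Pi.single_apply]
  rw [hone]
  set G := fun x => fderiv ℝ (Fcg β d U) x (Pi.single i 1) with hG
  have hGd : Differentiable ℝ G := by
    have h1 := (contDiff_succ_iff_fderiv_apply (n := 1)).1
      (show ContDiff ℝ (1 + 1) (Fcg β d U) from by simpa [one_add_one_eq_two] using h.contDiff_F)
    exact (h1.2.2 (Pi.single i 1)).differentiable one_ne_zero
  have hinv : ∀ s : ℝ, G (a + s • fun _ => (1:ℝ)) = G a := by
    intro s
    have e : (s • fun _ => (1:ℝ) : Fin (2*d) → ℝ) = fun _ => s := by funext k; simp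
    rw [e]
    simp only [hG]
    rw [← fderiv_comp_add_right]
    congr 2
    funext x
    exact F_shift x s
  have hl : HasLineDerivAt ℝ G (fderiv ℝ G a (fun _ => 1)) a (fun _ => 1) :=
    (hGd a).hasFDerivAt.hasLineDerivAt _
  unfold HasLineDerivAt at hl
  simp only [hinv] at hl
  exact hl.unique (hasDerivAt_const _ _)

lemma var_Z (h : Good d β U U1 U2 K) (hd : 1 ≤ d) (hβ : 0 < β) {C₂ : ℝ} (hC₂ : 0 < C₂)
    (hU2 : ∀ s, U2 s ≤ C₂) (a : Fin (2*d) → ℝ) :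
    (Zsite β d U a)^2 / (2*β*(2*d*C₂)) ≤ (Zsite β d U a) * (∫ t, t^2 * siteWeight β d U a t) -
      (∫ t, t * siteWeight β d U a t)^2 := by
  have hd0 : (0:ℝ) < d := by exact_mod_cast hd
  have ct : Continuous (fun x : (Fin (2*d) → ℝ) × ℝ => x.2) := continuous_snd
  have bt : ∀ (a : Fin (2*d) → ℝ) (t : ℝ), |t| ≤ 1 * (1 + ‖a‖ + |t|) := fun a t => by
    linarith [norm_nonneg a]
  have cW : Continuous (fun x : (Fin (2*d) → ℝ) × ℝ => -(2*β) * ∑ k, U1 (x.1 k - x.2)) :=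
    continuous_const.mul (continuous_finsetSum _ fun k _ => h.cont1 k)
  have bW : ∀ (a : Fin (2*d) → ℝ) (t : ℝ), |-(2*β) * ∑ k, U1 (a k - t)| ≤
      (2*β*(2*d*K)) * (1 + ‖a‖ + |t|) := by
    intro a t
    rw [abs_mul, abs_neg, abs_of_pos (by positivity : 0 < 2*β), mul_assoc (2*β)]
    refine mul_le_mul_of_nonneg_left ?_ (by positivity)
    refine (Finset.abs_sum_le_sum_abs _ _).trans ((Finset.sum_le_sum fun k _ => h.bd1 k a t).trans ?_)
    simp [mul_assoc]
  have cW2 : Continuous (fun x : (Fin (2*d) → ℝ) × ℝ => (2*β) * ∑ k, U2 (x.1 k - x.2)) :=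
    continuous_const.mul (continuous_finsetSum _ fun k _ => h.cont2 k)
  have bW2 : ∀ (a : Fin (2*d) → ℝ) (t : ℝ), |(2*β) * ∑ k, U2 (a k - t)| ≤ 2*β*(2*d*K) := by
    intro a t
    rw [abs_mul, abs_of_pos (by positivity : 0 < 2*β)]
    refine mul_le_mul_of_nonneg_left ?_ (by positivity)
    refine (Finset.abs_sum_le_sum_abs _ _).trans ((Finset.sum_le_sum fun k _ => h.b2 _).trans ?_)
    simp
  have hder : ∀ (f f' : ℝ → ℝ), (∀ s, HasDerivAt f (f' s) s) → ∀ t,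
      HasDerivAt (fun t => ∑ k, f (a k - t)) (∑ k, - f' (a k - t)) t := by
    intro f f' hf t
    refine HasDerivAt.fun_sum fun k _ => ?_
    have := (hf (a k - t)).comp t ((hasDerivAt_id t).const_sub (a k))
    simpa using! this
  refine var_lower (w := siteWeight β d U a) (W1 := fun t => -(2*β) * ∑ k, U1 (a k - t))
    (W2 := fun t => (2*β) * ∑ k, U2 (a k - t)) (by positivity) (fun t => (Real.exp_pos _).le)
    (h.Zpos a) ?_ ?_ ?_ (h.admw.integrable a) ?_ ?_ ?_ ?_ ?_ ?_
  · intro t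
    refine ((hder U U1 h.d1 t).const_mul (-(2*β))).exp.congr_deriv ?_
    rw [Finset.sum_neg_distrib]
    unfold siteWeight
    ring
  · intro t
    refine ((hder U1 U2 h.d2 t).const_mul (-(2*β))).congr_deriv ?_
    rw [Finset.sum_neg_distrib]
    ring
  · intro t
    refine mul_le_mul_of_nonneg_left ?_ (by positivity)
    refine (Finset.sum_le_sum fun k _ => hU2 _).trans ?_
    simp
  · have := (h.admProd (p := fun _ t => t) (p' := fun _ t => t) 1 1 ct ct bt bt).integrable a
    simpa only [← pow_two] using this
  · exact (h.admLin (p := fun _ t => t) 1 ct bt).integrable a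
  · exact (h.admLin (p := fun a t => -(2*β) * ∑ k, U1 (a k - t)) _ cW bW).integrable a
  · exact (h.admProd (p := fun _ t => t) (p' := fun a t => -(2*β) * ∑ k, U1 (a k - t))
      1 _ ct cW bt bW).integrable a
  · exact (h.admProd (p := fun a t => -(2*β) * ∑ k, U1 (a k - t))
      (p' := fun a t => -(2*β) * ∑ k, U1 (a k - t)) _ _ cW cW bW bW).integrable a
  · exact (h.admBdd (p := fun a t => (2*β) * ∑ k, U2 (a k - t)) _ cW2 bW2).integrable a

lemma cov_Z (h : Good d β U U1 U2 K) {α γ : ℝ} (i j : Fin (2*d)) (a : Fin (2*d) → ℝ)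
    (hp : ∀ s t, α * (t - s)^2 - γ ≤ (U1 (a i - t) - U1 (a i - s)) * (U1 (a j - t) - U1 (a j - s))) :
    α * (2 * ((Zsite β d U a) * (∫ t, t^2 * siteWeight β d U a t) -
      (∫ t, t * siteWeight β d U a t)^2)) - γ * (Zsite β d U a)^2 ≤
    2 * ((Zsite β d U a) * (∫ t, U1 (a i - t) * U1 (a j - t) * siteWeight β d U a t) -
      (∫ t, U1 (a i - t) * siteWeight β d U a t) * (∫ t, U1 (a j - t) * siteWeight β d U a t)) := by
  have ct : Continuous (fun x : (Fin (2*d) → ℝ) × ℝ => x.2) := continuous_snd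
  have bt : ∀ (a : Fin (2*d) → ℝ) (t : ℝ), |t| ≤ 1 * (1 + ‖a‖ + |t|) := fun a t => by
    linarith [norm_nonneg a]
  refine cov_lower (fun t => (Real.exp_pos _).le) ((h.adm11 i j).integrable a)
    ((h.adm1 i).integrable a) ((h.adm1 j).integrable a) (h.admw.integrable a) ?_ ?_ hp
  · have := (h.admProd (p := fun _ t => t) (p' := fun _ t => t) 1 1 ct ct bt bt).integrable a
    simpa only [← pow_two] using this
  · exact (h.admLin (p := fun _ t => t) 1 ct bt).integrable a

end Good

/-- random walk representation condition, Theorem 4.1 / `rw`. -/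
theorem statement0
    {d : ℕ} {β A B C₀ C₁ C₂ q : ℝ} {U V g : ℝ → ℝ}
    (hd : 1 ≤ d) (hβ : 0 < β)
    -- (A0)
    (hUcont : Continuous U) (hA : 0 < A) (hA0 : ∀ η : ℝ, A * η ^ 2 - B ≤ U η)
    -- (A1)
    (hsum : ∀ s, U s = V s + g s)
    (hV : ContDiff ℝ 2 V) (hg : ContDiff ℝ 2 g)
    (hC₁ : 0 < C₁) (hC₁₂ : C₁ < C₂) (hC₂₀ : C₂ < C₀)
    (hV'' : ∀ s, C₁ ≤ deriv (deriv V) s ∧ deriv (deriv V) s ≤ C₂)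
    (hg'' : ∀ s, -C₀ ≤ deriv (deriv g) s ∧ deriv (deriv g) s ≤ 0)
    -- (A2)
    (hq : 1 ≤ q)
    (hgq : Integrable (fun t : ℝ => |deriv (deriv g) t| ^ q))
    (hA2 : β ^ (1/(2*q)) * LqNorm (deriv (deriv g)) q
      < C₁ ^ ((3:ℝ)/2) / (2 * C₂ ^ ((q+1)/(2*q)) * (2*(d:ℝ)) ^ (1/(2*q)))) :
    ContDiff ℝ 2 (Fcg β d U) ∧
    ∃ c C : ℝ, 0 < c ∧ c ≤ C ∧ ∀ a : Fin (2*d) → ℝ,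
      (∀ i : Fin (2*d),
        pd2 (Fcg β d U) i i a = - ∑ j ∈ Finset.univ.erase i, pd2 (Fcg β d U) i j a) ∧
      (∀ i j : Fin (2*d), i ≠ j →
        c ≤ - pd2 (Fcg β d U) i j a ∧ - pd2 (Fcg β d U) i j a ≤ C) := by
  have hC₂ : 0 < C₂ := hC₁.trans hC₁₂
  have hd0 : (0:ℝ) < d := by exact_mod_cast hd
  have hq0 : 0 < q := by linarith
  have hV1 : ContDiff ℝ 1 (deriv V) := ((contDiff_succ_iff_deriv (n := 1)).1 hV).2.2
  have hg1 : ContDiff ℝ 1 (deriv g) := ((contDiff_succ_iff_deriv (n := 1)).1 hg).2.2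
  have hUe : U = fun s => V s + g s := funext hsum
  set U1 : ℝ → ℝ := fun s => deriv V s + deriv g s with hU1
  set U2 : ℝ → ℝ := fun s => deriv (deriv V) s + deriv (deriv g) s with hU2
  have d1 : ∀ s, HasDerivAt U (U1 s) s := fun s => by
    rw [hUe]
    exact ((hV.differentiable two_ne_zero s).hasDerivAt).add
      ((hg.differentiable two_ne_zero s).hasDerivAt)
  have d2 : ∀ s, HasDerivAt U1 (U2 s) s := fun s =>
    ((hV1.differentiable one_ne_zero s).hasDerivAt).add
      ((hg1.differentiable one_ne_zero s).hasDerivAt)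
  have b2 : ∀ s, |U2 s| ≤ C₂ + C₀ := fun s => by
    rw [abs_le]
    simp only [hU2]
    constructor <;> linarith [hV'' s, hg'' s, (hV'' s).1, (hV'' s).2, (hg'' s).1, (hg'' s).2]
  have hU2C : ∀ s, U2 s ≤ C₂ := fun s => by
    simp only [hU2]; linarith [(hV'' s).2, (hg'' s).2]
  have b1 : ∀ s, |U1 s| ≤ |U1 0| + (C₂ + C₀) * |s| := fun s => by
    have := Convex.norm_image_sub_le_of_norm_hasDerivWithin_le (f := U1) (f' := U2) (s := Set.univ)
      (C := C₂ + C₀) (x := 0) (y := s)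
      (fun x _ => (d2 x).hasDerivWithinAt) (fun x _ => b2 x) convex_univ trivial trivial
    rw [sub_zero, Real.norm_eq_abs, Real.norm_eq_abs] at this
    have h2 := abs_sub_abs_le_abs_sub (U1 s) (U1 0)
    linarith
  have G : Good d β U U1 U2 (|U1 0| + (C₂ + C₀)) :=
    { adm := fun p L hp hL => adm_weight hd hβ hUcont hA hA0 hp hL
      d1 := d1
      d2 := d2
      c2 := hV1.continuous_deriv_one.add hg1.continuous_deriv_one
      b1 := fun s => by
        have := b1 s
        nlinarith [mul_nonneg (abs_nonneg (U1 0)) (abs_nonneg s)]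
      b2 := fun s => by linarith [b2 s, abs_nonneg (U1 0)]
      K0 := by linarith [abs_nonneg (U1 0)] }
  refine ⟨G.contDiff_F, ?_⟩
  -- constants
  set τ : ℝ := 1 / (2 * β * d * C₂) with hτdef
  have hτ : 0 < τ := by positivity
  set N := LqNorm (deriv (deriv g)) q with hN
  have hN0 : 0 ≤ N := by
    rw [hN]; unfold LqNorm
    exact Real.rpow_nonneg (integral_nonneg fun t => by positivity) _
  set R : ℝ := C₁ ^ 3 / (4 * C₂) * τ ^ (1 / q) with hR
  have hRpos : 0 < R := by positivity
  have hNR : N ^ 2 < R := by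
    have sq : (β ^ (1/(2*q)) * N) ^ 2 <
        (C₁ ^ ((3:ℝ)/2) / (2 * C₂ ^ ((q+1)/(2*q)) * (2*(d:ℝ)) ^ (1/(2*q)))) ^ 2 :=
      pow_lt_pow_left₀ hA2 (by positivity) two_ne_zero
    have hsq : ∀ x y : ℝ, 0 < x → (x ^ y) ^ 2 = x ^ (2 * y) := fun x y hx => by
      rw [← Real.rpow_natCast (x ^ y), ← Real.rpow_mul hx.le, mul_comm]; norm_num
    have e1 : 2 * (1 / (2 * q)) = 1 / q := by field_simp
    have e2 : 2 * ((q + 1) / (2 * q)) = 1 + 1 / q := by field_simp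
    have e3 : 2 * ((3:ℝ) / 2) = (3 : ℕ) := by norm_num
    rw [mul_pow, div_pow, mul_pow, mul_pow, hsq _ _ hβ, hsq _ _ hC₁, hsq _ _ hC₂,
      hsq _ _ (by positivity : 0 < 2 * (d:ℝ)), e1, e2, e3, Real.rpow_natCast,
      Real.rpow_add hC₂, Real.rpow_one] at sq
    have hτe : τ ^ (1 / q) = 1 / (β ^ (1/q) * (2 * (d:ℝ)) ^ (1/q) * C₂ ^ (1/q)) := by
      rw [hτdef, Real.div_rpow zero_le_one (by positivity), Real.one_rpow,
        show 2 * β * d * C₂ = β * (2 * d) * C₂ by ring,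
        Real.mul_rpow (by positivity) (by positivity), Real.mul_rpow (by positivity) (by positivity)]
    rw [hR, hτe]
    have hb : 0 < β ^ (1/q) := by positivity
    refine lt_of_mul_lt_mul_left (sq.trans_eq ?_) hb.le
    field_simp
    norm_num
  set u := N ^ 2 / R with hu
  have hu0 : 0 ≤ u := by positivity
  have hu1 : u < 1 := by rw [hu, div_lt_one hRpos]; exact hNR
  set θ := (1 + u) / 2 with hθdef
  have hθ : 0 < θ := by positivity
  have hθ1 : θ < 1 := by rw [hθdef]; linarith
  have hNθ : N ^ 2 ≤ θ ^ 2 * C₁ ^ 3 / (4 * C₂) * τ ^ (1 / q) := by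
    have h1 : N ^ 2 = u * R := by rw [hu]; field_simp
    have h2 : u ≤ θ ^ 2 := by rw [hθdef]; nlinarith [sq_nonneg (1 - u)]
    calc N ^ 2 = u * R := h1
      _ ≤ θ ^ 2 * R := by gcongr
      _ = _ := by rw [hR]; ring
  have pair : ∀ b b' s t : ℝ, C₁ ^ 2 * (1 - θ + θ / (2 * q)) * (t - s) ^ 2 - C₁ ^ 2 * θ * τ / (2 * q) ≤
      (U1 (b - t) - U1 (b - s)) * (U1 (b' - t) - U1 (b' - s)) :=
    pair_lower hV hg hC₁ hC₂ hV'' (fun s => (hg'' s).2) hq hτ hθ hθ1 hgq hNθ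
  set c : ℝ := (2*β)^2 * (C₁ ^ 2 * τ * (1 - θ) / 2) with hc
  have hc0 : 0 < c := by
    have : 0 < 1 - θ := by linarith
    positivity
  have low : ∀ a (i j : Fin (2*d)), i ≠ j → c ≤ - pd2 (Fcg β d U) i j a := by
    intro a i j hij
    rw [G.pd2_F, G.Z2_eq, if_neg hij.symm, neg_neg]
    have hcov := G.cov_Z i j a (pair (a i) (a j))
    have hvar := G.var_Z hd hβ hC₂ hU2C a
    have hZ := G.Zpos a
    set Z := Zsite β d U a
    rw [le_div_iff₀ (by positivity)]
    have hα : 0 ≤ C₁ ^ 2 * (1 - θ + θ / (2 * q)) := by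
      have : 0 < 1 - θ := by linarith
      positivity
    have hv2 := mul_le_mul_of_nonneg_left hvar hα
    have e : Z ^ 2 / (2 * β * (2 * d * C₂)) = τ / 2 * Z ^ 2 := by
      rw [hτdef]; field_simp
    rw [e] at hv2
    have e2 : C₁ ^ 2 * (1 - θ + θ / (2 * q)) * (2 * (τ / 2 * Z ^ 2)) - C₁ ^ 2 * θ * τ / (2 * q) * Z ^ 2
        = C₁ ^ 2 * τ * (1 - θ) * Z ^ 2 := by
      field_simp; ring
    have h3 : C₁ ^ 2 * τ * (1 - θ) / 2 * Z ^ 2 ≤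
        Z * (∫ t, U1 (a i - t) * U1 (a j - t) * siteWeight β d U a t) -
      (∫ t, U1 (a i - t) * siteWeight β d U a t) * (∫ t, U1 (a j - t) * siteWeight β d U a t) := by
      linarith
    have h4 := mul_le_mul_of_nonneg_left h3 (by positivity : 0 ≤ (2*β)^2)
    rw [hc]
    linarith
  have diag : ∀ a (i : Fin (2*d)), pd2 (Fcg β d U) i i a ≤ 2 * β * C₂ := by
    intro a i
    rw [G.pd2_F, G.Z2_eq, if_pos rfl]
    have hcov := G.cov_Z (α := 0) (γ := 0) i i a (fun s t => by
      nlinarith [sq_nonneg (U1 (a i - t) - U1 (a i - s))])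
    have hZ := G.Zpos a
    have hI : ∫ t, U2 (a i - t) * siteWeight β d U a t ≤ C₂ * Zsite β d U a := by
      unfold Zsite
      rw [← integral_const_mul]
      exact integral_mono ((G.adm2 i).integrable a) ((G.admw.integrable a).const_mul C₂)
        fun t => mul_le_mul_of_nonneg_right (hU2C _) (Real.exp_pos _).le
    set Z := Zsite β d U a
    rw [← neg_div, div_le_iff₀ (by positivity)]
    have h4 := mul_nonneg (by positivity : 0 ≤ (2*β)^2) (by linarith : 0 ≤ Z * (∫ t, U1 (a i - t) * U1 (a i - t) * siteWeight β d U a t) -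
      (∫ t, U1 (a i - t) * siteWeight β d U a t) * (∫ t, U1 (a i - t) * siteWeight β d U a t))
    have h5 := mul_le_mul_of_nonneg_left hI (by positivity : 0 ≤ 2 * β * Z)
    linarith
  have row : ∀ a (i : Fin (2*d)),
      pd2 (Fcg β d U) i i a = - ∑ j ∈ Finset.univ.erase i, pd2 (Fcg β d U) i j a := by
    intro a i
    have h1 := G.rowsum i a
    rw [← Finset.add_sum_erase _ _ (Finset.mem_univ i)] at h1
    linarith
  refine ⟨c, max c (2 * β * C₂), hc0, le_max_left _ _, fun a => ⟨row a, fun i j hij => ⟨low a i j hij, ?_⟩⟩⟩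
  refine le_trans ?_ (le_max_right _ _)
  refine le_trans ?_ (diag a i)
  rw [row a i, ← Finset.sum_neg_distrib]
  exact Finset.single_le_sum (f := fun j => - pd2 (Fcg β d U) i j a)
    (fun k hk => hc0.le.trans (low a i k (Finset.ne_of_mem_erase hk).symm))
    (Finset.mem_erase.2 ⟨hij.symm, Finset.mem_univ j⟩)

end
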